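/- arXiv:2307.14271 — 3 statements merged into one kernel-verified Lean document; each statement's English description precedes it below -/
import Mathlib

section
/- Let θ ∈ (0,1], C₁ ≥ 0 and x, y ∈ ℝ². Then |exp(C₁⟨x⟩^θ) − exp(C₁⟨x+y⟩^θ)| ≤ C₁ · ⟨y⟩ · ( exp(C₁⟨x⟩^θ) + exp(C₁⟨x+y⟩^θ) ), where ⟨x⟩ := √(1 + ‖x‖²) denotes the Japanese bracket. -/
/-- The Japanese bracket `⟨x⟩ = √(1 + ‖x‖²)` on `ℝ²`. -/
noncomputable def jbracket (x : EuclideanSpace ℝ (Fin 2)) : ℝ :=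
  Real.sqrt (1 + ‖x‖ ^ 2)

theorem one_le_jbracket (x : EuclideanSpace ℝ (Fin 2)) : 1 ≤ jbracket x :=
  Real.one_le_sqrt.2 (le_add_of_nonneg_right (sq_nonneg _))

theorem jbracket_neg (x : EuclideanSpace ℝ (Fin 2)) : jbracket (-x) = jbracket x := by
  simp [jbracket]

theorem norm_le_jbracket (x : EuclideanSpace ℝ (Fin 2)) : ‖x‖ ≤ jbracket x :=
  Real.le_sqrt_of_sq_le (by linarith)

theorem jbracket_add_le (x y : EuclideanSpace ℝ (Fin 2)) :
    jbracket (x + y) ≤ jbracket x + jbracket y := by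
  have hx : jbracket x ^ 2 = 1 + ‖x‖ ^ 2 := Real.sq_sqrt (by positivity)
  have hy : jbracket y ^ 2 = 1 + ‖y‖ ^ 2 := Real.sq_sqrt (by positivity)
  have hx1 := one_le_jbracket x
  have hy1 := one_le_jbracket y
  have hadd : ‖x + y‖ ^ 2 ≤ (‖x‖ + ‖y‖) ^ 2 := by
    gcongr
    exact norm_add_le x y
  have hmul : ‖x‖ * ‖y‖ ≤ jbracket x * jbracket y :=
    mul_le_mul (norm_le_jbracket x) (norm_le_jbracket y) (norm_nonneg y) (by linarith)
  exact Real.sqrt_le_iff.2 ⟨by linarith, by nlinarith⟩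

/-- On `[1, ∞)` the increments of `s ↦ s ^ θ`, `θ ≤ 1`, are at most those of the identity. -/
theorem Real.rpow_sub_rpow_le_sub {θ s t : ℝ} (hθ : θ ≤ 1) (hs : 1 ≤ s) (hst : s ≤ t) :
    t ^ θ - s ^ θ ≤ t - s := by
  have hs0 : 0 < s := by linarith
  have hratio : (t / s) ^ θ ≤ t / s :=
    Real.rpow_le_self_of_one_le ((one_le_div hs0).2 hst) hθ
  have hsθ : s ^ θ ≤ s := Real.rpow_le_self_of_one_le hs hθ
  have hpos : 0 < s ^ θ := Real.rpow_pos_of_pos hs0 θ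
  have ht : t ^ θ = s ^ θ * (t / s) ^ θ := by
    rw [← Real.mul_rpow hs0.le (div_nonneg (hs0.le.trans hst) hs0.le), mul_div_cancel₀ _ hs0.ne']
  calc t ^ θ - s ^ θ ≤ s ^ θ * (t / s) - s ^ θ := by rw [ht]; gcongr
    _ = s ^ θ * (t / s - 1) := by ring
    _ ≤ s * (t / s - 1) := by
      gcongr
      exact sub_nonneg.2 ((one_le_div hs0).2 hst)
    _ = t - s := by field_simp

theorem Real.exp_sub_exp_le (u v : ℝ) : Real.exp u - Real.exp v ≤ (u - v) * Real.exp u := by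
  have h : Real.exp v = Real.exp (v - u) * Real.exp u := by rw [← Real.exp_add]; ring_nf
  nlinarith [Real.add_one_le_exp (v - u), Real.exp_pos u]

theorem exp_mul_rpow_sub_le {θ C s t d : ℝ} (hθ0 : 0 ≤ θ) (hθ1 : θ ≤ 1) (hC : 0 ≤ C)
    (hs : 1 ≤ s) (ht : 1 ≤ t) (hd : 0 ≤ d) (htd : t ≤ s + d) :
    Real.exp (C * t ^ θ) - Real.exp (C * s ^ θ) ≤ C * d * Real.exp (C * t ^ θ) := by
  have hpow : t ^ θ - s ^ θ ≤ d := by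
    rcases le_total s t with hst | hts
    · linarith [Real.rpow_sub_rpow_le_sub hθ1 hs hst]
    · linarith [Real.rpow_le_rpow (by linarith) hts hθ0]
  refine (Real.exp_sub_exp_le _ _).trans ?_
  rw [← mul_sub]
  gcongr

/-- For `θ ∈ (0,1]`, `C₁ ≥ 0` and `x, y ∈ ℝ²`:
`|exp(C₁⟨x⟩^θ) − exp(C₁⟨x+y⟩^θ)| ≤ C₁ ⟨y⟩ (exp(C₁⟨x⟩^θ) + exp(C₁⟨x+y⟩^θ))`. -/
theorem gevrey_weight_commutator (θ C₁ : ℝ) (hθ0 : 0 < θ) (hθ1 : θ ≤ 1) (hC : 0 ≤ C₁)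
    (x y : EuclideanSpace ℝ (Fin 2)) :
    |Real.exp (C₁ * jbracket x ^ θ) - Real.exp (C₁ * jbracket (x + y) ^ θ)| ≤
      C₁ * jbracket y *
        (Real.exp (C₁ * jbracket x ^ θ) + Real.exp (C₁ * jbracket (x + y) ^ θ)) := by
  have hx := one_le_jbracket x
  have hxy := one_le_jbracket (x + y)
  have hy : 0 ≤ jbracket y := by linarith [one_le_jbracket y]
  have hle : jbracket x ≤ jbracket (x + y) + jbracket y := by
    simpa [jbracket_neg] using jbracket_add_le (x + y) (-y)
  have h₁ := exp_mul_rpow_sub_le hθ0.le hθ1 hC hxy hx hy hle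
  have h₂ := exp_mul_rpow_sub_le hθ0.le hθ1 hC hx hxy hy (jbracket_add_le x y)
  have hCy : 0 ≤ C₁ * jbracket y := mul_nonneg hC hy
  have hpos₁ := mul_nonneg hCy (Real.exp_nonneg (C₁ * jbracket x ^ θ))
  have hpos₂ := mul_nonneg hCy (Real.exp_nonneg (C₁ * jbracket (x + y) ^ θ))
  rw [mul_add, abs_sub_le_iff]
  constructor <;> linarith
end

section
/- Let σ ≥ 1 and t ≥ 0 be real numbers, let k, l be integers and η a real number, and write ⟨(a,b)⟩ := √(1+a²+b²) and ⟨a⟩ := √(1+a²). If ⟨(l,lt)⟩ ≥ (1/2)·⟨(k,η)⟩, then ⟨(k,η)⟩ · ( ⟨(k,η)⟩^σ + ⟨(k−l, η−lt)⟩^σ ) / ( ⟨(l,lt)⟩^σ · ⟨(k−l, η−lt)⟩^σ ) ≤ 2^{σ+1} · ( ⟨t⟩·⟨l⟩·⟨k−l⟩^{−σ} + ⟨l⟩^{1−σ} ). -/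
/-- If `0 < a ≤ 2 b`, `0 < p ≤ b ≤ q` and `0 < m ≤ c`, then
`a (a^σ + c^σ) / (b^σ c^σ) ≤ 2^(σ+1) (q m^(-σ) + p^(1-σ))` for `σ ≥ 1`. -/
theorem mul_rpow_add_rpow_div_le {σ a b c p q m : ℝ} (hσ : 1 ≤ σ) (ha : 0 < a)
    (hab : a ≤ 2 * b) (hp : 0 < p) (hpb : p ≤ b) (hbq : b ≤ q) (hm : 0 < m) (hmc : m ≤ c) :
    a * (a ^ σ + c ^ σ) / (b ^ σ * c ^ σ) ≤ 2 ^ (σ + 1) * (q * m ^ (-σ) + p ^ (1 - σ)) := by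
  have hb : 0 < b := hp.trans_le hpb
  have hc : 0 < c := hm.trans_le hmc
  have hbσ : 0 < b ^ σ := Real.rpow_pos_of_pos hb σ
  have hcσ : 0 < c ^ σ := Real.rpow_pos_of_pos hc σ
  have split : a * (a ^ σ + c ^ σ) / (b ^ σ * c ^ σ) =
      a ^ (σ + 1) / b ^ σ * c ^ (-σ) + a / b ^ σ := by
    rw [Real.rpow_add_one ha.ne', Real.rpow_neg hc.le]
    field_simp
  have quot_le : a ^ (σ + 1) / b ^ σ ≤ 2 ^ (σ + 1) * q := by
    rw [div_le_iff₀ hbσ]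
    calc a ^ (σ + 1) ≤ (2 * b) ^ (σ + 1) := by gcongr
      _ = 2 ^ (σ + 1) * b * b ^ σ := by
        rw [Real.mul_rpow zero_le_two hb.le, Real.rpow_add_one hb.ne']
        ring
      _ ≤ 2 ^ (σ + 1) * q * b ^ σ := by gcongr
  have neg_le : c ^ (-σ) ≤ m ^ (-σ) :=
    Real.rpow_le_rpow_of_nonpos hm hmc (by linarith)
  have two_le : (2 : ℝ) ≤ 2 ^ (σ + 1) :=
    Real.self_le_rpow_of_one_le one_le_two (by linarith)
  have tail_le : a / b ^ σ ≤ 2 ^ (σ + 1) * p ^ (1 - σ) := by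
    calc a / b ^ σ ≤ 2 * b / b ^ σ := by gcongr
      _ = 2 * b ^ (1 - σ) := by rw [Real.rpow_sub hb, Real.rpow_one, mul_div_assoc]
      _ ≤ 2 ^ (σ + 1) * p ^ (1 - σ) :=
        mul_le_mul two_le (Real.rpow_le_rpow_of_nonpos hp hpb (by linarith))
          (by positivity) (by positivity)
  have hq : 0 < q := hb.trans_le hbq
  rw [split, mul_add, ← mul_assoc]
  exact add_le_add (mul_le_mul quot_le neg_le (by positivity) (by positivity)) tail_le

/-- Polynomial weight-ratio estimate in the case `⟨(l,lt)⟩ ≥ ½⟨(k,η)⟩`: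
`⟨(k,η)⟩ (⟨(k,η)⟩^σ + ⟨(k−l,η−lt)⟩^σ) / (⟨(l,lt)⟩^σ ⟨(k−l,η−lt)⟩^σ)
  ≤ 2^(σ+1) (⟨t⟩⟨l⟩⟨k−l⟩^(−σ) + ⟨l⟩^(1−σ))`,
where `⟨(a,b)⟩ = √(1+a²+b²)` and `⟨a⟩ = √(1+a²)`. -/
theorem weight_ratio_estimate (σ t : ℝ) (hσ : 1 ≤ σ) (ht : 0 ≤ t) (k l : ℤ) (η : ℝ)
    (hcase : Real.sqrt (1 + (k : ℝ) ^ 2 + η ^ 2) / 2 ≤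
      Real.sqrt (1 + (l : ℝ) ^ 2 + ((l : ℝ) * t) ^ 2)) :
    Real.sqrt (1 + (k : ℝ) ^ 2 + η ^ 2) *
        (Real.sqrt (1 + (k : ℝ) ^ 2 + η ^ 2) ^ σ +
          Real.sqrt (1 + ((k : ℝ) - l) ^ 2 + (η - l * t) ^ 2) ^ σ) /
        (Real.sqrt (1 + (l : ℝ) ^ 2 + ((l : ℝ) * t) ^ 2) ^ σ *
          Real.sqrt (1 + ((k : ℝ) - l) ^ 2 + (η - l * t) ^ 2) ^ σ) ≤
      2 ^ (σ + 1) *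
        (Real.sqrt (1 + t ^ 2) * Real.sqrt (1 + (l : ℝ) ^ 2) *
            Real.sqrt (1 + ((k : ℝ) - l) ^ 2) ^ (-σ) +
          Real.sqrt (1 + (l : ℝ) ^ 2) ^ (1 - σ)) := by
  refine mul_rpow_add_rpow_div_le hσ (by positivity) (by linarith) (by positivity)
    (Real.sqrt_le_sqrt ?_) ?_ (by positivity) (Real.sqrt_le_sqrt ?_)
  · nlinarith [sq_nonneg ((l : ℝ) * t)]
  · rw [← Real.sqrt_mul (by positivity)]
    exact Real.sqrt_le_sqrt (by nlinarith [sq_nonneg t])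
  · nlinarith [sq_nonneg (η - l * t)]
end

section
/- Let σ ≥ 1 be a real number, let k ≥ 1 be a real number, and let 0 ≤ t and t/2 ≤ s ≤ t. Then (1+k²+k²t²)^{σ/2} · (1+k²(t−s)²)^{−σ/2} · (1+k²+k²s²)^{−σ/2} · (t−s) · (1+t²)^{(σ−1)/2} · (1+s²)^{(1−σ)/2} ≤ 2^{2σ−1} · k^{−1} · (1+(t−s)²)^{(1−σ)/2}. -/
theorem rpow_mul_rpow_neg_le_two_rpow {a c p : ℝ} (ha : 0 ≤ a) (hc : 0 < c)
    (hac : a ≤ 4 * c) (hp : 0 ≤ p) : a ^ p * c ^ (-p) ≤ 2 ^ (2 * p) := by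
  have h : a ^ p ≤ 2 ^ (2 * p) * c ^ p := by
    calc a ^ p ≤ (4 * c) ^ p := Real.rpow_le_rpow ha hac hp
      _ = 2 ^ (2 * p) * c ^ p := by
        rw [Real.mul_rpow (by norm_num) hc.le, Real.rpow_mul (by norm_num)]
        norm_num
  rw [Real.rpow_neg hc.le, ← div_eq_mul_inv]
  exact (div_le_iff₀ (Real.rpow_pos_of_pos hc p)).2 h

theorem japanese_rpow_neg_mul_le {σ k r : ℝ} (hσ : 1 ≤ σ) (hk : 1 ≤ k) (hr : 0 ≤ r) :
    (1 + k ^ 2 * r ^ 2) ^ (-(σ / 2)) * r ≤ k⁻¹ * (1 + r ^ 2) ^ ((1 - σ) / 2) := by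
  have hk0 : 0 < k := by linarith
  have hB : 0 < 1 + k ^ 2 * r ^ 2 := by positivity
  have hsplit : (1 + k ^ 2 * r ^ 2) ^ (-(σ / 2)) =
      (1 + k ^ 2 * r ^ 2) ^ ((1 - σ) / 2) * (√(1 + k ^ 2 * r ^ 2))⁻¹ := by
    rw [Real.sqrt_eq_rpow, ← Real.rpow_neg hB.le, ← Real.rpow_add hB]
    congr 1
    ring
  have hmono : (1 + k ^ 2 * r ^ 2) ^ ((1 - σ) / 2) ≤ (1 + r ^ 2) ^ ((1 - σ) / 2) := by
    refine Real.rpow_le_rpow_of_nonpos (by positivity) ?_ (by linarith)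
    nlinarith [mul_nonneg (sub_nonneg.2 (one_le_pow₀ hk : 1 ≤ k ^ 2)) (sq_nonneg r)]
  have hroot : (√(1 + k ^ 2 * r ^ 2))⁻¹ * r ≤ k⁻¹ := by
    have h : k * r ≤ √(1 + k ^ 2 * r ^ 2) := Real.le_sqrt_of_sq_le (by nlinarith)
    rw [inv_mul_le_iff₀ (Real.sqrt_pos.2 hB), ← div_eq_mul_inv, le_div_iff₀ hk0]
    linarith
  rw [hsplit, mul_assoc, mul_comm k⁻¹]
  exact mul_le_mul hmono hroot (by positivity) (by positivity)

/-- Pointwise kernel estimate in the diagonal case `l = k`, `s ≥ t/2`: for `σ ≥ 1`,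
`k ≥ 1`, `0 ≤ t`, `t/2 ≤ s ≤ t`, the Duhamel kernel satisfies
`⟨(k,kt)⟩^σ ⟨(0,k(t−s))⟩^(−σ) ⟨(k,ks)⟩^(−σ) (t−s) ⟨t⟩^(σ−1) ⟨s⟩^(1−σ)
  ≤ 2^(2σ−1) k⁻¹ ⟨t−s⟩^(1−σ)`. -/
theorem diagonal_kernel_estimate (σ k t s : ℝ) (hσ : 1 ≤ σ) (hk : 1 ≤ k)
    (ht : 0 ≤ t) (hs1 : t / 2 ≤ s) (hs2 : s ≤ t) :
    (1 + k ^ 2 + k ^ 2 * t ^ 2) ^ (σ / 2) * (1 + k ^ 2 * (t - s) ^ 2) ^ (-(σ / 2)) *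
        (1 + k ^ 2 + k ^ 2 * s ^ 2) ^ (-(σ / 2)) * (t - s) *
        (1 + t ^ 2) ^ ((σ - 1) / 2) * (1 + s ^ 2) ^ ((1 - σ) / 2) ≤
      2 ^ (2 * σ - 1) * k⁻¹ * (1 + (t - s) ^ 2) ^ ((1 - σ) / 2) := by
  have hts : t ^ 2 ≤ 4 * s ^ 2 := by nlinarith
  have h1 := rpow_mul_rpow_neg_le_two_rpow (a := 1 + k ^ 2 + k ^ 2 * t ^ 2)
    (c := 1 + k ^ 2 + k ^ 2 * s ^ 2) (p := σ / 2) (by positivity) (by positivity)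
    (by nlinarith [mul_le_mul_of_nonneg_left hts (sq_nonneg k), sq_nonneg k]) (by linarith)
  have h2 := rpow_mul_rpow_neg_le_two_rpow (a := 1 + t ^ 2) (c := 1 + s ^ 2)
    (p := (σ - 1) / 2) (by positivity) (by positivity) (by linarith) (by linarith)
  have h3 := japanese_rpow_neg_mul_le hσ hk (sub_nonneg.2 hs2)
  rw [show -((σ - 1) / 2) = (1 - σ) / 2 by ring] at h2
  have hr : 0 ≤ t - s := sub_nonneg.2 hs2
  calc
    _ = ((1 + k ^ 2 + k ^ 2 * t ^ 2) ^ (σ / 2) * (1 + k ^ 2 + k ^ 2 * s ^ 2) ^ (-(σ / 2))) *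
          ((1 + t ^ 2) ^ ((σ - 1) / 2) * (1 + s ^ 2) ^ ((1 - σ) / 2)) *
          ((1 + k ^ 2 * (t - s) ^ 2) ^ (-(σ / 2)) * (t - s)) := by ring
    _ ≤ 2 ^ (2 * (σ / 2)) * 2 ^ (2 * ((σ - 1) / 2)) *
          (k⁻¹ * (1 + (t - s) ^ 2) ^ ((1 - σ) / 2)) := by gcongr
    _ = _ := by
      rw [← Real.rpow_add two_pos, mul_assoc (2 ^ (2 * σ - 1))]
      congr 2
      ring
end
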